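/- In a Rado complex X, the link of every simplex is a Rado complex: for every simplex σ ∈ F(X), the simplicial complex Lk_X(σ), consisting of all simplexes τ ∈ F(X) with τ ∩ σ = ∅ and τ ∪ σ ∈ F(X), is a Rado complex. -/

import Mathlib

/-- An (abstract) simplicial complex with vertices drawn from `ℕ`:
a set of nonempty finite subsets of `ℕ` (the simplexes) closed under
passing to nonempty subsets.  The vertex set `V(X)` is the set of `v`
with `{v}` a simplex. -/
structure SComplex where
  faces : Set (Finset ℕ)
  nonempty_of_mem : ∀ s ∈ faces, s.Nonempty
  down_closed : ∀ s ∈ faces, ∀ t ⊆ s, t.Nonempty → t ∈ faces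

namespace SComplex

/-- The vertex set of a simplicial complex. -/
def vertexSet (X : SComplex) : Set ℕ := {v | {v} ∈ X.faces}

/-- The subcomplex of `X` induced on a set `U` of vertices. -/
def induced (X : SComplex) (U : Set ℕ) : SComplex where
  faces := {s | s ∈ X.faces ∧ (↑s : Set ℕ) ⊆ U}
  nonempty_of_mem := fun s hs => X.nonempty_of_mem s hs.1
  down_closed := fun s hs t hts ht =>
    ⟨X.down_closed s hs.1 t hts ht,
     fun x hx => hs.2 (Finset.mem_coe.mpr (hts (Finset.mem_coe.mp hx)))⟩

/-- The link of a vertex `v`: all simplexes `σ` with `v ∉ σ` and `σ ∪ {v}` a simplex. -/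
def link (X : SComplex) (v : ℕ) : SComplex where
  faces := {s | s ∈ X.faces ∧ v ∉ s ∧ insert v s ∈ X.faces}
  nonempty_of_mem := fun s hs => X.nonempty_of_mem s hs.1
  down_closed := fun s hs t hts ht =>
    ⟨X.down_closed s hs.1 t hts ht,
     fun hv => hs.2.1 (hts hv),
     X.down_closed _ hs.2.2 _ (Finset.insert_subset_insert v hts)
       (Finset.insert_nonempty v t)⟩

/-- `IsIso X Y f` : the map `f` is an isomorphism of simplicial complexes from `X` to `Y`,
i.e. a bijection of the vertex sets which induces a bijection between the sets of simplexes. -/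
def IsIso (X Y : SComplex) (f : ℕ → ℕ) : Prop :=
  Set.BijOn f X.vertexSet Y.vertexSet ∧
    ∀ s : Finset ℕ, (↑s : Set ℕ) ⊆ X.vertexSet → (s ∈ X.faces ↔ s.image f ∈ Y.faces)

/-- Two simplicial complexes are isomorphic. -/
def Isomorphic (X Y : SComplex) : Prop := ∃ f, IsIso X Y f

/-- `X` is universal: every countable simplicial complex is isomorphic to an induced
subcomplex of `X`. -/
def Universal (X : SComplex) : Prop :=
  ∀ Y : SComplex, Y.vertexSet.Countable →
    ∃ U ⊆ X.vertexSet, Isomorphic Y (X.induced U)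

/-- `X` is homogeneous: every isomorphism between finite induced subcomplexes of `X`
extends to an isomorphism of `X` onto itself. -/
def Homogeneous (X : SComplex) : Prop :=
  ∀ U U' : Set ℕ, U.Finite → U'.Finite → U ⊆ X.vertexSet → U' ⊆ X.vertexSet →
    ∀ f : ℕ → ℕ, IsIso (X.induced U) (X.induced U') f →
      ∃ F : ℕ → ℕ, IsIso X X F ∧ Set.EqOn F f U

/-- A Rado complex: a countable simplicial complex which is universal and homogeneous. -/
def IsRado (X : SComplex) : Prop :=
  X.vertexSet.Countable ∧ Universal X ∧ Homogeneous X

/-- The ampleness condition: for every finite `U ⊆ V(X)` and every subcomplex `A` of the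
induced complex `X_U` there is a vertex `v ∈ V(X) - U` with `Lk_X(v) ∩ X_U = A`. -/
def AmpleProp (X : SComplex) : Prop :=
  ∀ U : Set ℕ, U.Finite → U ⊆ X.vertexSet →
    ∀ A : SComplex, A.faces ⊆ (X.induced U).faces →
      ∃ v ∈ X.vertexSet \ U, (X.link v).faces ∩ (X.induced U).faces = A.faces

/-- An ample complex: a countable simplicial complex satisfying the ampleness condition. -/
def IsAmple (X : SComplex) : Prop := X.vertexSet.Countable ∧ AmpleProp X

/-- `L'` is an induced subcomplex of `L`. -/
def IsInduced (L' L : SComplex) : Prop :=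
  L'.faces ⊆ L.faces ∧ ∀ s ∈ L.faces, (↑s : Set ℕ) ⊆ L'.vertexSet → s ∈ L'.faces

end SComplex

/-- The link of a simplex `σ`: all simplexes `τ` disjoint from `σ` with `τ ∪ σ` a simplex. -/
def SComplex.linkSimplex (X : SComplex) (σ : Finset ℕ) : SComplex where
  faces := {τ | τ ∈ X.faces ∧ Disjoint τ σ ∧ τ ∪ σ ∈ X.faces}
  nonempty_of_mem := fun τ hτ => X.nonempty_of_mem τ hτ.1
  down_closed := fun τ hτ t hts ht =>
    ⟨X.down_closed τ hτ.1 t hts ht,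
     Disjoint.mono_left hts hτ.2.1,
     X.down_closed _ hτ.2.2 _ (Finset.union_subset_union_left hts) ht.inl⟩

namespace SComplex

/-- A finite set of pairs is a partial isomorphism from `Y` to `Z` if it is the graph of an
injective map between finite sets of vertices which preserves and reflects simplexes. -/
structure IsPartialIso (Y Z : SComplex) (p : Finset (ℕ × ℕ)) : Prop where
  mem_vertexSet : ∀ a ∈ p, a.1 ∈ Y.vertexSet ∧ a.2 ∈ Z.vertexSet
  fst_eq_iff : ∀ a ∈ p, ∀ b ∈ p, a.1 = b.1 ↔ a.2 = b.2
  faces_iff : ∀ q ⊆ p, q.image Prod.fst ∈ Y.faces ↔ q.image Prod.snd ∈ Z.faces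

theorem vertexSet_of_mem_faces {X : SComplex} {s : Finset ℕ} (hs : s ∈ X.faces) {v : ℕ}
    (hv : v ∈ s) : v ∈ X.vertexSet :=
  X.down_closed s hs {v} (by simpa using hv) (by simp)

theorem vertexSet_induced {X : SComplex} {U : Set ℕ} (hU : U ⊆ X.vertexSet) :
    (X.induced U).vertexSet = U := by
  ext v
  simp only [vertexSet, induced, Set.mem_ofPred_eq, Finset.coe_singleton,
    Set.singleton_subset_iff]
  exact ⟨fun h => h.2, fun h => ⟨hU h, h⟩⟩

namespace IsPartialIso

variable {Y Z : SComplex} {p : Finset (ℕ × ℕ)}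

theorem empty : IsPartialIso Y Z ∅ where
  mem_vertexSet := by simp
  fst_eq_iff := by simp
  faces_iff q hq := by
    obtain rfl := Finset.subset_empty.mp hq
    exact ⟨fun h => absurd (Y.nonempty_of_mem _ h) (by simp),
      fun h => absurd (Z.nonempty_of_mem _ h) (by simp)⟩

theorem mono {q : Finset (ℕ × ℕ)} (hp : IsPartialIso Y Z p)
    (hq : q ⊆ p) : IsPartialIso Y Z q where
  mem_vertexSet a ha := hp.mem_vertexSet a (hq ha)
  fst_eq_iff a ha b hb := hp.fst_eq_iff a (hq ha) b (hq hb)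
  faces_iff r hr := hp.faces_iff r (hr.trans hq)

theorem swap (hp : IsPartialIso Y Z p) : IsPartialIso Z Y (p.image Prod.swap) where
  mem_vertexSet a ha := by
    obtain ⟨b, hb, rfl⟩ := Finset.mem_image.mp ha
    exact (hp.mem_vertexSet b hb).symm
  fst_eq_iff a ha b hb := by
    obtain ⟨c, hc, rfl⟩ := Finset.mem_image.mp ha
    obtain ⟨d, hd, rfl⟩ := Finset.mem_image.mp hb
    exact (hp.fst_eq_iff c hc d hd).symm
  faces_iff q hq := by
    obtain ⟨r, hr, rfl⟩ := Finset.subset_image_iff.mp hq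
    simpa [Finset.image_image, Function.comp_def] using (hp.faces_iff r hr).symm

theorem exists_extend_fst (hZ : Z.AmpleProp) (hp : IsPartialIso Y Z p) {n : ℕ}
    (hn : n ∈ Y.vertexSet) : ∃ q, IsPartialIso Y Z q ∧ p ⊆ q ∧ ∃ m, (n, m) ∈ q := by
  by_cases h : ∃ m, (n, m) ∈ p
  · exact ⟨p, hp, subset_rfl, h⟩
  push Not at h
  let A : SComplex :=
    { faces := {t | t.Nonempty ∧ t ⊆ p.image Prod.snd ∧
        insert n ((p.filter (·.2 ∈ t)).image Prod.fst) ∈ Y.faces}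
      nonempty_of_mem := fun s hs => hs.1
      down_closed := fun s hs t hts ht => by
        refine ⟨ht, hts.trans hs.2.1, Y.down_closed _ hs.2.2 _ ?_ (Finset.insert_nonempty _ _)⟩
        refine Finset.insert_subset_insert _ (Finset.image_subset_image fun a ha => ?_)
        rw [Finset.mem_filter] at ha ⊢
        exact ⟨ha.1, hts ha.2⟩ }
  have hfilter : ∀ q ⊆ p, p.filter (·.2 ∈ q.image Prod.snd) = q := by
    intro q hq
    ext a
    simp only [Finset.mem_filter, Finset.mem_image]
    constructor
    · rintro ⟨ha, b, hb, hba⟩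
      have h1 := (hp.fst_eq_iff b (hq hb) a ha).mpr hba
      rwa [← Prod.ext h1 hba]
    · exact fun ha => ⟨hq ha, a, ha, rfl⟩
  have hA_iff : ∀ q ⊆ p, q.Nonempty →
      (q.image Prod.snd ∈ A.faces ↔ insert n (q.image Prod.fst) ∈ Y.faces) := by
    intro q hq hqn
    change (_ ∧ _ ∧ _) ↔ _
    rw [hfilter q hq]
    exact ⟨fun h => h.2.2, fun h => ⟨hqn.image _, Finset.image_subset_image hq, h⟩⟩
  have hAU : A.faces ⊆ (Z.induced ↑(p.image Prod.snd)).faces := by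
    intro t ht
    obtain ⟨q, hq, rfl⟩ := Finset.subset_image_iff.mp ht.2.1
    have hqn : q.Nonempty := by simpa using ht.1
    refine ⟨(hp.faces_iff q hq).mp ?_, by exact_mod_cast ht.2.1⟩
    exact Y.down_closed _ ((hA_iff q hq hqn).mp ht) _ (Finset.subset_insert _ _) (hqn.image _)
  obtain ⟨v, ⟨hvZ, hvU⟩, hv⟩ := hZ (↑(p.image Prod.snd)) (Finset.finite_toSet _)
    (fun x hx => by
      obtain ⟨a, ha, rfl⟩ := Finset.mem_image.mp (Finset.mem_coe.mp hx)
      exact (hp.mem_vertexSet a ha).2) A hAU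
  have hvp : ∀ a ∈ p, a.2 ≠ v := fun a ha h =>
    hvU (Finset.mem_coe.mpr (Finset.mem_image.mpr ⟨a, ha, h⟩))
  have hnp : ∀ a ∈ p, a.1 ≠ n := fun a ha han => h a.2 (by rwa [← han])
  refine ⟨insert (n, v) p, ⟨?_, ?_, ?_⟩, Finset.subset_insert _ _, v,
    Finset.mem_insert_self _ _⟩
  · intro a ha
    rcases Finset.mem_insert.mp ha with rfl | ha
    · exact ⟨hn, hvZ⟩
    · exact hp.mem_vertexSet a ha
  · intro a ha b hb
    rcases Finset.mem_insert.mp ha with rfl | ha <;> rcases Finset.mem_insert.mp hb with rfl | hb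
    · simp
    · simp [(hnp b hb).symm, (hvp b hb).symm]
    · simp [hnp a ha, hvp a ha]
    · exact hp.fst_eq_iff a ha b hb
  · intro q hq
    by_cases hnq : (n, v) ∈ q
    · obtain ⟨r, hr, rfl⟩ : ∃ r ⊆ p, q = insert (n, v) r :=
        ⟨q.erase (n, v), by rwa [← Finset.subset_insert_iff],
          (Finset.insert_erase hnq).symm⟩
      rw [Finset.image_insert, Finset.image_insert]
      rcases r.eq_empty_or_nonempty with rfl | hrn
      · simpa using ⟨fun _ => hvZ, fun _ => hn⟩
      · rw [← hA_iff r hr hrn, ← hv]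
        refine ⟨fun h => h.1.2.2, fun h => ?_⟩
        have hrZ := Z.down_closed _ h _ (Finset.subset_insert _ _) (hrn.image Prod.snd)
        refine ⟨⟨hrZ, fun hvr => ?_, h⟩, hrZ, ?_⟩
        · exact hvU (Finset.mem_coe.mpr (Finset.image_subset_image hr hvr))
        · exact_mod_cast Finset.image_subset_image hr
    · exact hp.faces_iff q ((Finset.subset_insert_iff_of_notMem hnq).mp hq)

theorem exists_extend_snd (hY : Y.AmpleProp) (hp : IsPartialIso Y Z p) {n : ℕ}
    (hn : n ∈ Z.vertexSet) : ∃ q, IsPartialIso Y Z q ∧ p ⊆ q ∧ ∃ m, (m, n) ∈ q := by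
  obtain ⟨q, hq, hpq, m, hm⟩ := hp.swap.exists_extend_fst hY hn
  refine ⟨q.image Prod.swap, hq.swap, fun a ha => ?_, m, ?_⟩
  · exact Finset.mem_image.mpr ⟨a.swap, hpq (Finset.mem_image_of_mem _ ha), a.swap_swap⟩
  · exact Finset.mem_image.mpr ⟨(n, m), hm, rfl⟩

end IsPartialIso

/-- Countably many density conditions on finite approximations can be met simultaneously. -/
theorem exists_generic_set {α : Type*} {P : Finset α → Prop} {D : ℕ → Finset α → Prop}
    (hD : ∀ n p, P p → ∃ q, P q ∧ p ⊆ q ∧ D n q) {p₀ : Finset α} (h₀ : P p₀) :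
    ∃ R : Set α, ↑p₀ ⊆ R ∧ (∀ q : Finset α, ↑q ⊆ R → ∃ p, P p ∧ q ⊆ p) ∧
      ∀ n, ∃ p, D n p ∧ ↑p ⊆ R := by
  classical
  let 𝒟 : ℕ → Order.Cofinal {p // P p} := fun n =>
    { carrier := {p | D n p.1}
      isCofinal := fun p => by
        obtain ⟨q, hq, hpq, hDq⟩ := hD n p.1 p.2
        exact ⟨⟨q, hq⟩, hDq, hpq⟩ }
  let I := Order.idealOfCofinals ⟨p₀, h₀⟩ 𝒟
  refine ⟨{a | ∃ p ∈ I, a ∈ p.1}, fun a ha => ⟨_, Order.mem_idealOfCofinals _ 𝒟, ha⟩, ?_, ?_⟩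
  · suffices H : ∀ q : Finset α, ↑q ⊆ {a | ∃ p ∈ I, a ∈ p.1} → ∃ p ∈ I, q ⊆ p.1 by
      intro q hq
      obtain ⟨p, -, hqp⟩ := H q hq
      exact ⟨p.1, p.2, hqp⟩
    intro q
    induction q using Finset.induction_on with
    | empty => exact fun _ => ⟨_, Order.mem_idealOfCofinals _ 𝒟, Finset.empty_subset _⟩
    | insert a s _ ih =>
      intro hq
      rw [Finset.coe_insert, Set.insert_subset_iff] at hq
      obtain ⟨p, hpI, hp⟩ := hq.1
      obtain ⟨p', hpI', hp'⟩ := ih hq.2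
      obtain ⟨r, hrI, hpr, hpr'⟩ := I.directed p hpI p' hpI'
      exact ⟨r, hrI, Finset.insert_subset (hpr hp) (hp'.trans hpr')⟩
  · intro n
    obtain ⟨p, hp, hpI⟩ := Order.cofinal_meets_idealOfCofinals ⟨p₀, h₀⟩ 𝒟 n
    exact ⟨p.1, hp, fun a ha => ⟨p, hpI, ha⟩⟩

/-- A set of pairs all of whose finite subsets are partial isomorphisms, and whose domain is the
whole vertex set, contains the graph of an isomorphism onto an induced subcomplex. -/
theorem exists_map_of_isPartialIso {Y Z : SComplex} {R : Set (ℕ × ℕ)}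
    (hR : ∀ q : Finset (ℕ × ℕ), ↑q ⊆ R → IsPartialIso Y Z q)
    (hdom : ∀ n ∈ Y.vertexSet, ∃ m, (n, m) ∈ R) :
    ∃ f : ℕ → ℕ, (∀ n m, (n, m) ∈ R → f n = m) ∧ Set.MapsTo f Y.vertexSet Z.vertexSet ∧
      Set.InjOn f Y.vertexSet ∧
      ∀ s : Finset ℕ, (↑s : Set ℕ) ⊆ Y.vertexSet → (s ∈ Y.faces ↔ s.image f ∈ Z.faces) := by
  have hpair : ∀ a ∈ R, ∀ b ∈ R, IsPartialIso Y Z {a, b} := fun a ha b hb =>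
    hR _ (by simp [Set.insert_subset_iff, ha, hb])
  choose! f hf using hdom
  refine ⟨f, fun n m h => ?_, fun n hn => ?_, fun n hn m hm h => ?_, fun s hs => ?_⟩
  · have hn := ((hpair _ h _ h).mem_vertexSet (n, m) (by simp)).1
    exact ((hpair _ (hf n hn) _ h).fst_eq_iff (n, f n) (by simp) (n, m) (by simp)).mp rfl
  · exact ((hpair _ (hf n hn) _ (hf n hn)).mem_vertexSet (n, f n) (by simp)).2
  · exact ((hpair _ (hf n hn) _ (hf m hm)).fst_eq_iff (n, f n) (by simp) (m, f m)
      (by simp)).mpr h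
  · have hq : IsPartialIso Y Z (s.image fun n => (n, f n)) := hR _ (by
      intro a ha
      simp only [Finset.coe_image, Set.mem_image] at ha
      obtain ⟨n, hn, rfl⟩ := ha
      exact hf n (hs hn))
    simpa [Finset.image_image, Function.comp_def] using hq.faces_iff _ subset_rfl

theorem AmpleProp.universal {Z : SComplex} (hZ : Z.AmpleProp) : Z.Universal := by
  intro Y _
  obtain ⟨R, -, hR, hD⟩ := exists_generic_set (P := IsPartialIso Y Z)
    (D := fun n p => n ∈ Y.vertexSet → ∃ m, (n, m) ∈ p)
    (fun n p hp => by
      by_cases hn : n ∈ Y.vertexSet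
      · obtain ⟨q, hq, hpq, hm⟩ := hp.exists_extend_fst hZ hn
        exact ⟨q, hq, hpq, fun _ => hm⟩
      · exact ⟨p, hp, subset_rfl, fun h => absurd h hn⟩) IsPartialIso.empty
  obtain ⟨f, -, hmaps, hinj, hfaces⟩ := exists_map_of_isPartialIso (Y := Y) (Z := Z) (R := R)
    (fun q hq => by
      obtain ⟨p, hp, hqp⟩ := hR q hq
      exact hp.mono hqp)
    (fun n hn => by
      obtain ⟨p, hp, hpR⟩ := hD n
      obtain ⟨m, hm⟩ := hp hn
      exact ⟨m, hpR hm⟩)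
  refine ⟨f '' Y.vertexSet, hmaps.image_subset, f, ?_, fun s hs => ?_⟩
  · rw [vertexSet_induced hmaps.image_subset]
    exact hinj.bijOn_image
  · rw [hfaces s hs]
    exact ⟨fun h => ⟨h, by rw [Finset.coe_image]; exact Set.image_mono hs⟩, fun h => h.1⟩

theorem AmpleProp.homogeneous {X : SComplex} (hX : X.AmpleProp) : X.Homogeneous := by
  intro U U' hU _ hUX hUX' f hf
  lift U to Finset ℕ using hU
  obtain ⟨hbij, hfaces⟩ := hf
  rw [vertexSet_induced hUX, vertexSet_induced hUX'] at hbij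
  rw [vertexSet_induced hUX] at hfaces
  have h₀ : IsPartialIso X X (U.image fun n => (n, f n)) := by
    refine ⟨fun a ha => ?_, fun a ha b hb => ?_, fun q hq => ?_⟩
    · obtain ⟨n, hn, rfl⟩ := Finset.mem_image.mp ha
      exact ⟨hUX hn, hUX' (hbij.mapsTo hn)⟩
    · obtain ⟨n, hn, rfl⟩ := Finset.mem_image.mp ha
      obtain ⟨m, hm, rfl⟩ := Finset.mem_image.mp hb
      exact (hbij.injOn.eq_iff hn hm).symm
    · obtain ⟨s, hs, rfl⟩ := Finset.subset_image_iff.mp hq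
      have hsU : (↑s : Set ℕ) ⊆ ↑U := by exact_mod_cast hs
      have himg : (↑(s.image f) : Set ℕ) ⊆ U' := by
        rw [Finset.coe_image]
        exact (hbij.mapsTo.mono_left hsU).image_subset
      have key := hfaces s hsU
      simp only [induced, Set.mem_ofPred_eq, hsU, himg, and_true] at key
      simpa [Finset.image_image, Function.comp_def] using key
  obtain ⟨R, h₀R, hR, hD⟩ := exists_generic_set (P := IsPartialIso X X)
    (D := fun n p => n ∈ X.vertexSet → (∃ m, (n, m) ∈ p) ∧ ∃ m, (m, n) ∈ p)
    (fun n p hp => by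
      by_cases hn : n ∈ X.vertexSet
      · obtain ⟨q, hq, hpq, m, hm⟩ := hp.exists_extend_fst hX hn
        obtain ⟨r, hr, hqr, hm'⟩ := hq.exists_extend_snd hX hn
        exact ⟨r, hr, hpq.trans hqr, fun _ => ⟨⟨m, hqr hm⟩, hm'⟩⟩
      · exact ⟨p, hp, subset_rfl, fun h => absurd h hn⟩) h₀
  have hR' : ∀ q : Finset (ℕ × ℕ), ↑q ⊆ R → IsPartialIso X X q := fun q hq => by
    obtain ⟨p, hp, hqp⟩ := hR q hq
    exact hp.mono hqp
  obtain ⟨F, hFR, hmaps, hinj, hFfaces⟩ := exists_map_of_isPartialIso hR' (fun n hn => by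
      obtain ⟨p, hp, hpR⟩ := hD n
      obtain ⟨m, hm⟩ := (hp hn).1
      exact ⟨m, hpR hm⟩)
  refine ⟨F, ⟨⟨hmaps, hinj, fun n hn => ?_⟩, hFfaces⟩, fun n hn => ?_⟩
  · obtain ⟨p, hp, hpR⟩ := hD n
    obtain ⟨m, hm⟩ := (hp hn).2
    have hmR := hpR hm
    exact ⟨m, ((hR' {(m, n)} (by simpa using hmR)).mem_vertexSet (m, n) (by simp)).1,
      hFR m n hmR⟩
  · exact hFR n (f n) (h₀R (Finset.mem_coe.mpr (Finset.mem_image_of_mem _ hn)))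

theorem IsAmple.isRado {X : SComplex} (hX : X.IsAmple) : X.IsRado :=
  ⟨hX.1, hX.2.universal, hX.2.homogeneous⟩

/-- The complex obtained from `X` by attaching a cone with apex `w` over the subcomplex `A`. -/
def attachCone (X A : SComplex) (w : ℕ) : SComplex where
  faces := {s | s.Nonempty ∧ (s.erase w = ∅ ∨ s.erase w ∈ X.faces) ∧
    (w ∈ s → s.erase w = ∅ ∨ s.erase w ∈ A.faces)}
  nonempty_of_mem := fun s hs => hs.1
  down_closed := fun s hs t hts ht => by
    have hsub : t.erase w ⊆ s.erase w := Finset.erase_subset_erase w hts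
    have aux : ∀ B : SComplex, (s.erase w = ∅ ∨ s.erase w ∈ B.faces) →
        (t.erase w = ∅ ∨ t.erase w ∈ B.faces) := by
      rintro B (h | h)
      · exact Or.inl (Finset.subset_empty.mp (h ▸ hsub))
      · exact (t.erase w).eq_empty_or_nonempty.imp id (B.down_closed _ h _ hsub)
    exact ⟨ht, aux X hs.2.1, fun hw => aux A (hs.2.2 (hts hw))⟩

theorem mem_attachCone_of_notMem {X A : SComplex} {w : ℕ} {s : Finset ℕ} (hw : w ∉ s) :
    s ∈ (attachCone X A w).faces ↔ s ∈ X.faces := by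
  simp only [attachCone, Set.mem_ofPred_eq, Finset.erase_eq_of_notMem hw, hw, false_imp_iff,
    and_true]
  refine ⟨fun h => h.2.resolve_left h.1.ne_empty, fun h => ⟨X.nonempty_of_mem _ h, Or.inr h⟩⟩

theorem insert_mem_attachCone {X A : SComplex} (hA : A.faces ⊆ X.faces) {w : ℕ} {s : Finset ℕ}
    (hw : w ∉ s) : insert w s ∈ (attachCone X A w).faces ↔ s = ∅ ∨ s ∈ A.faces := by
  simp only [attachCone, Set.mem_ofPred_eq, Finset.erase_insert hw, Finset.mem_insert_self,
    true_imp_iff, Finset.insert_nonempty, true_and]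
  exact ⟨fun h => h.2, fun h => ⟨h.imp id (@hA s), h⟩⟩

theorem IsRado.isAmple {X : SComplex} (hX : X.IsRado) : X.IsAmple := by
  obtain ⟨hc, huniv, hhom⟩ := hX
  refine ⟨hc, fun U hU hUX A hA => ?_⟩
  obtain ⟨w, hw⟩ := hU.exists_notMem
  set Y := attachCone (X.induced U) A w with hY
  obtain ⟨W, hWX, g, hgbij, hgfaces⟩ := huniv Y (Set.to_countable _)
  rw [vertexSet_induced hWX] at hgbij
  have hwY : w ∈ Y.vertexSet := by
    have := (insert_mem_attachCone hA (Finset.notMem_empty w)).mpr (Or.inl rfl)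
    rwa [insert_empty_eq] at this
  have hUY : U ⊆ Y.vertexSet := fun u hu =>
    (mem_attachCone_of_notMem (by simpa using fun h : w = u => hw (h ▸ hu))).mpr
      ⟨hUX hu, by simpa using hu⟩
  have hgX : ∀ s : Finset ℕ, (↑s : Set ℕ) ⊆ Y.vertexSet →
      (s ∈ Y.faces ↔ s.image g ∈ X.faces) := fun s hs => by
    rw [hgfaces s hs]
    refine ⟨fun h => h.1, fun h => ⟨h, ?_⟩⟩
    rw [Finset.coe_image]
    exact (hgbij.mapsTo.mono_left hs).image_subset
  have hginj : Set.InjOn g U := hgbij.injOn.mono hUY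
  have hgU : g '' U ⊆ X.vertexSet := ((hgbij.mapsTo.mono_left hUY).image_subset).trans hWX
  have hinv : ∀ u ∈ U, Function.invFunOn g U (g u) = u := fun u hu =>
    hginj.leftInvOn_invFunOn hu
  have himage_inv : ∀ s : Finset ℕ, (↑s : Set ℕ) ⊆ U →
      (s.image g).image (Function.invFunOn g U) = s := fun s hs => by
    rw [Finset.image_image]
    conv_rhs => rw [← Finset.image_id (s := s)]
    exact Finset.image_congr fun u hu => hinv u (hs hu)
  have hUfaces : ∀ s : Finset ℕ, (↑s : Set ℕ) ⊆ U → (s ∈ X.faces ↔ s.image g ∈ X.faces) :=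
    fun s hs => by
      rw [← hgX s (hs.trans hUY), hY, mem_attachCone_of_notMem fun h => hw (hs h)]
      exact ⟨fun h => ⟨h, hs⟩, fun h => h.1⟩
  obtain ⟨F, ⟨hFbij, hFfaces⟩, hFeq⟩ := hhom (g '' U) U (hU.image g) hU hgU hUX
    (Function.invFunOn g U) (by
      refine ⟨?_, fun s hs => ?_⟩
      · rw [vertexSet_induced hgU, vertexSet_induced hUX]
        refine ⟨?_, ?_, fun u hu => ⟨g u, ⟨u, hu, rfl⟩, hinv u hu⟩⟩
        · rintro _ ⟨u, hu, rfl⟩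
          rwa [hinv u hu]
        · rintro _ ⟨u, hu, rfl⟩ _ ⟨u', hu', rfl⟩ h
          rw [hinv u hu, hinv u' hu'] at h
          rw [h]
      · rw [vertexSet_induced hgU] at hs
        obtain ⟨t, ht, rfl⟩ := Finset.subset_set_image_iff.mp hs
        rw [himage_inv t ht]
        exact ⟨fun h => ⟨(hUfaces t ht).mpr h.1, ht⟩,
          fun h => ⟨(hUfaces t ht).mp h.1, hs⟩⟩)
  have hFg : ∀ u ∈ U, F (g u) = u := fun u hu => by
    rw [hFeq ⟨u, hu, rfl⟩, hinv u hu]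
  have hgw : g w ∈ X.vertexSet := hWX (hgbij.mapsTo hwY)
  have hvU : F (g w) ∉ U := fun h => by
    have h1 := hFbij.injOn (hgU ⟨_, h, rfl⟩) hgw (hFg _ h)
    exact hw (hgbij.injOn (hUY h) hwY h1 ▸ h)
  have hinsert : ∀ s : Finset ℕ, (↑s : Set ℕ) ⊆ U →
      (insert (F (g w)) s ∈ X.faces ↔ s = ∅ ∨ s ∈ A.faces) := fun s hs => by
    rw [← insert_mem_attachCone hA (fun h => hw (hs h) : w ∉ s), ← hY, hgX _ (by
      rw [Finset.coe_insert]; exact Set.insert_subset hwY (hs.trans hUY)), hFfaces ((insert w s).image g) (by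
      intro x hx
      obtain ⟨y, hy, rfl⟩ := Finset.mem_image.mp (Finset.mem_coe.mp hx)
      rcases Finset.mem_insert.mp hy with rfl | hy
      · exact hgw
      · exact hgU ⟨y, hs hy, rfl⟩)]
    have : (s.image g).image F = s := by
      rw [Finset.image_image]
      conv_rhs => rw [← Finset.image_id (s := s)]
      exact Finset.image_congr fun u hu => hFg u (hs hu)
    rw [Finset.image_insert, Finset.image_insert, this]
  refine ⟨F (g w), ⟨hFbij.mapsTo hgw, hvU⟩, Set.ext fun s => ⟨?_, fun hs => ?_⟩⟩
  · rintro ⟨⟨-, -, h⟩, hsX, hsU⟩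
    exact ((hinsert s hsU).mp h).resolve_left (X.nonempty_of_mem s hsX).ne_empty
  · obtain ⟨hsX, hsU⟩ := hA hs
    exact ⟨⟨hsX, fun h => hvU (hsU h), (hinsert s hsU).mpr (Or.inr hs)⟩, hsX, hsU⟩

theorem IsAmple.linkSimplex {X : SComplex} (hX : X.IsAmple) {σ : Finset ℕ} (hσ : σ ∈ X.faces) :
    (X.linkSimplex σ).IsAmple := by
  refine ⟨Set.to_countable _, fun U hU hUL A hA => ?_⟩
  have hUX : U ⊆ X.vertexSet := fun u hu => (hUL hu).1
  let B : SComplex :=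
    { faces := {s | s.Nonempty ∧ (s ⊆ σ ∨ s \ σ ∈ A.faces)}
      nonempty_of_mem := fun s hs => hs.1
      down_closed := fun s hs t hts ht => by
        refine ⟨ht, ?_⟩
        rw [← Finset.sdiff_eq_empty_iff_subset]
        rcases hs.2 with h | h
        · exact Or.inl (Finset.sdiff_eq_empty_iff_subset.mpr (hts.trans h))
        · exact (t \ σ).eq_empty_or_nonempty.imp id
            (A.down_closed _ h _ (Finset.sdiff_subset_sdiff hts subset_rfl)) }
  have hB : B.faces ⊆ (X.induced (U ∪ ↑σ)).faces := by
    rintro s ⟨hsn, h | h⟩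
    · exact ⟨X.down_closed σ hσ s h hsn, fun x hx => Or.inr (h hx)⟩
    · obtain ⟨⟨-, -, h1⟩, h2⟩ := hA h
      refine ⟨X.down_closed _ h1 s (by simp) hsn, fun x hx => ?_⟩
      by_cases hxσ : x ∈ σ
      · exact Or.inr hxσ
      · exact Or.inl (h2 (Finset.mem_coe.mpr (Finset.mem_sdiff.mpr ⟨hx, hxσ⟩)))
  obtain ⟨v, ⟨hvX, hvU⟩, hv⟩ := hX.2 (U ∪ ↑σ) (hU.union σ.finite_toSet)
    (Set.union_subset hUX fun x hx => vertexSet_of_mem_faces hσ hx) B hB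
  rw [Set.mem_union, not_or, Finset.mem_coe] at hvU
  have hσB : σ ∈ B.faces := ⟨X.nonempty_of_mem σ hσ, Or.inl subset_rfl⟩
  refine ⟨v, ⟨⟨hvX, by simpa using hvU.2, ?_⟩, hvU.1⟩, Set.ext fun s => ⟨?_, fun hs => ?_⟩⟩
  · rw [← hv] at hσB
    rw [← Finset.insert_eq]
    exact hσB.1.2.2
  · rintro ⟨⟨-, -, -, -, h⟩, ⟨hsX, hdisj, hsσ⟩, hsU⟩
    have hmem : s ∪ σ ∈ B.faces := by
      rw [← hv]
      refine ⟨⟨hsσ, ?_, by rwa [← Finset.insert_union]⟩, hsσ, ?_⟩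
      · rw [Finset.mem_union, not_or]
        exact ⟨fun h => hvU.1 (hsU h), hvU.2⟩
      · rw [Finset.coe_union]
        exact Set.union_subset_union_left _ hsU
    rcases hmem.2 with h | h
    · have hsub : s ⊆ σ := Finset.subset_union_left.trans h
      exact absurd (hdisj.eq_bot_of_le hsub) (X.nonempty_of_mem s hsX).ne_empty
    · rwa [Finset.union_sdiff_cancel_right hdisj] at h
  · obtain ⟨hsL, hsU⟩ := hA hs
    have hdisj := hsL.2.1
    have hsB : s ∪ σ ∈ B.faces :=
      ⟨(A.nonempty_of_mem s hs).mono Finset.subset_union_left,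
        Or.inr (by rwa [Finset.union_sdiff_cancel_right hdisj])⟩
    rw [← hv] at hsB
    have hins : insert v s ∪ σ ∈ X.faces := by
      rw [Finset.insert_union]
      exact hsB.1.2.2
    have hvs : v ∉ s := fun h => hvU.1 (hsU h)
    refine ⟨⟨hsL, hvs, X.down_closed _ hins _ Finset.subset_union_left
      (Finset.insert_nonempty _ _), ?_, hins⟩, hsL, hsU⟩
    rw [Finset.disjoint_insert_left]
    exact ⟨hvU.2, hdisj⟩

end SComplex

/-- In a Rado complex, the link of every simplex is a Rado complex. -/
theorem rado_link (X : SComplex) (hX : X.IsRado) (σ : Finset ℕ) (hσ : σ ∈ X.faces) :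
    (X.linkSimplex σ).IsRado := by
  exact (hX.isAmple.linkSimplex hσ).isRado
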